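/- arXiv:math/0207171 — 4 statements merged into one kernel-verified Lean document; each statement's English description precedes it below -/
import Mathlib

section
/- Let k be a field of characteristic p > 0 and let R = k[x,y,z]/(xᵖ − yᵖz). The k-algebra homomorphism ψ : R → k[u,v] determined by x ↦ uv, y ↦ v, z ↦ uᵖ is well defined (i.e. xᵖ − yᵖz lies in its kernel on k[x,y,z]) and injective, ψ induces an isomorphism of fraction fields Frac(R) ≅ k(u,v), and k[u,v] is integral over the image of ψ. Consequently k[u,v] is the integral closure of R in its fraction field, i.e. the normalization of R. -/
open MvPolynomial

/-- The ideal `(xᵖ - yᵖ z) ⊆ k[x,y,z]`. -/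
noncomputable def surfIdeal (k : Type) [Field k] (p : ℕ) : Ideal (MvPolynomial (Fin 3) k) :=
  Ideal.span {(X 0 : MvPolynomial (Fin 3) k) ^ p - X 1 ^ p * X 2}

/-- The `k`-algebra map `k[x,y,z] → k[u,v]`, `x ↦ uv`, `y ↦ v`, `z ↦ uᵖ`. -/
noncomputable def surfMap (k : Type) [Field k] (p : ℕ) :
    MvPolynomial (Fin 3) k →ₐ[k] MvPolynomial (Fin 2) k :=
  aeval ![X 0 * X 1, X 1, X 0 ^ p]

/-- An integral injection of domains into an integrally closed domain, surjective on fractions,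
identifies the fraction fields and the target with the integral closure of the source. -/
theorem exists_fractionRing_ringEquiv_image_integralClosure {A B : Type*} [CommRing A] [IsDomain A]
    [CommRing B] [IsDomain B] [IsIntegrallyClosed B] (f : A →+* B)
    (hinj : Function.Injective f) (hint : f.IsIntegral)
    (hfrac : ∀ b : B, ∃ s : A, s ≠ 0 ∧ ∃ a : A, f s * b = f a) :
    ∃ e : FractionRing A ≃+* FractionRing B,
      (∀ a : A, e (algebraMap A _ a) = algebraMap B _ (f a)) ∧
      e '' (integralClosure A (FractionRing A) : Set (FractionRing A)) =
        Set.range (algebraMap B (FractionRing B)) := by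
  let := f.toAlgebra
  have : Algebra.IsIntegral A B := ⟨hint⟩
  have htower (a : A) : algebraMap A (FractionRing B) a = algebraMap B _ (f a) :=
    IsScalarTower.algebraMap_apply A B (FractionRing B) a
  have hinj' : Function.Injective (algebraMap A (FractionRing B)) := by
    rw [IsScalarTower.algebraMap_eq A B (FractionRing B)]
    exact (IsFractionRing.injective B (FractionRing B)).comp hinj
  have : FaithfulSMul A (FractionRing B) := (faithfulSMul_iff_algebraMap_injective _ _).2 hinj'
  have : IsFractionRing A (FractionRing B) := by
    refine IsFractionRing.of_field A (FractionRing B) fun z => ?_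
    obtain ⟨b, c, hc, rfl⟩ := IsFractionRing.div_surjective (A := B) z
    obtain ⟨s, hs, a, h⟩ := hfrac b
    obtain ⟨t, ht, d, h'⟩ := hfrac c
    have hc0 : algebraMap B (FractionRing B) c ≠ 0 := by
      simpa using nonZeroDivisors.ne_zero hc
    have hs0 := (map_ne_zero_iff _ hinj').2 hs
    have ht0 := (map_ne_zero_iff _ hinj').2 ht
    have e1 := congrArg (algebraMap B (FractionRing B)) h
    have e2 := congrArg (algebraMap B (FractionRing B)) h'
    simp only [map_mul, ← htower] at e1 e2
    refine ⟨a * t, s * d, ?_⟩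
    rw [map_mul, map_mul, ← e1, ← e2]
    field_simp
  let e := IsLocalization.algEquiv (nonZeroDivisors A) (FractionRing A) (FractionRing B)
  refine ⟨e.toRingEquiv, fun a => (e.commutes a).trans (htower a), ?_⟩
  have : IsIntegralClosure B A (FractionRing B) := .of_isIntegrallyClosed B A (FractionRing B)
  ext z
  rw [Set.mem_range, ← IsIntegralClosure.isIntegral_iff (R := A) (A := B)]
  constructor
  · rintro ⟨w, hw, rfl⟩
    exact IsIntegral.map e hw
  · intro hz
    exact ⟨e.symm z, IsIntegral.map e.symm hz, e.apply_symm_apply z⟩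

section Surface

variable (k : Type) [Field k] (p : ℕ)

theorem mk_surfIdeal_relation :
    (Ideal.Quotient.mk (surfIdeal k p) (X 0)) ^ p =
      Ideal.Quotient.mk (surfIdeal k p) (X 1) ^ p * Ideal.Quotient.mk (surfIdeal k p) (X 2) := by
  rw [← map_pow, ← map_pow, ← map_mul, Ideal.Quotient.eq]
  exact Ideal.subset_span rfl

/-- The `k`-linear retraction `k[u,v] → k[x,y,z]/(xᵖ - yᵖ z)` sending `uᵃ vᵇ` to
`x ^ (a % p) * y ^ (b - a % p) * z ^ (a / p)`. -/
noncomputable def surfRetraction :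
    MvPolynomial (Fin 2) k →ₗ[k] MvPolynomial (Fin 3) k ⧸ surfIdeal k p :=
  (basisMonomials (Fin 2) k).constr k fun m =>
    Ideal.Quotient.mk (surfIdeal k p) (X 0 ^ (m 0 % p) * X 1 ^ (m 1 - m 0 % p) * X 2 ^ (m 0 / p))

theorem surfRetraction_X_pow_mul (a b : ℕ) :
    surfRetraction k p (X 0 ^ a * X 1 ^ b) =
      Ideal.Quotient.mk (surfIdeal k p) (X 0 ^ (a % p) * X 1 ^ (b - a % p) * X 2 ^ (a / p)) := by
  have h : (X 0 ^ a * X 1 ^ b : MvPolynomial (Fin 2) k) =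
      basisMonomials (Fin 2) k (Finsupp.single 0 a + Finsupp.single 1 b) := by
    rw [coe_basisMonomials, X_pow_eq_monomial, X_pow_eq_monomial, monomial_mul, one_mul]
  rw [h, surfRetraction, Module.Basis.constr_basis]
  simp

theorem surfRetraction_surfMap (hp : 0 < p) (F : MvPolynomial (Fin 3) k) :
    surfRetraction k p (surfMap k p F) = Ideal.Quotient.mk (surfIdeal k p) F := by
  suffices h : surfRetraction k p ∘ₗ (surfMap k p).toLinearMap =
      (Ideal.Quotient.mkₐ k (surfIdeal k p)).toLinearMap from LinearMap.congr_fun h F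
  refine (basisMonomials (Fin 3) k).ext fun m => ?_
  have hm : basisMonomials (Fin 3) k m = X 0 ^ m 0 * X 1 ^ m 1 * X 2 ^ m 2 := by
    simp [monomial_eq, Finsupp.prod_fintype, Fin.prod_univ_three]
  have hmap : surfMap k p (X 0 ^ m 0 * X 1 ^ m 1 * X 2 ^ m 2) =
      X 0 ^ (m 0 + p * m 2) * X 1 ^ (m 0 + m 1) := by
    simp only [surfMap, map_mul, map_pow, aeval_X, Matrix.cons_val]
    ring
  have hsub : m 0 + m 1 - m 0 % p = p * (m 0 / p) + m 1 := by
    have := Nat.mod_add_div (m 0) p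
    omega
  simp only [LinearMap.comp_apply, AlgHom.toLinearMap_apply, hm, hmap, surfRetraction_X_pow_mul,
    Nat.add_mul_mod_self_left, Nat.add_mul_div_left _ _ hp, hsub, Ideal.Quotient.mkₐ_eq_mk,
    map_mul, map_pow]
  conv_rhs => rw [← Nat.mod_add_div (m 0) p, pow_add, pow_mul, mk_surfIdeal_relation]
  ring

end Surface

set_option synthInstance.maxHeartbeats 800000 in
set_option maxHeartbeats 1600000 in
/-- **Normalization of `xᵖ = yᵖ z` in characteristic `p`.**  The map
`ψ : R = k[x,y,z]/(xᵖ - yᵖz) → k[u,v]`, `x ↦ uv`, `y ↦ v`, `z ↦ uᵖ`, is well defined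
(`xᵖ - yᵖz` lies in the kernel) and injective, it induces an isomorphism of fraction
fields `Frac R ≅ k(u,v)`, and `k[u,v]` is integral over the image of `ψ`; under the
induced identification of fraction fields, `k[u,v]` is exactly the integral closure of
`R` in its fraction field (the normalization of `R`). -/
theorem normalization_char_p (k : Type) [Field k] (p : ℕ) (hp : 0 < p) [CharP k p]
    (hker : surfIdeal k p ≤ RingHom.ker (surfMap k p))
    (ψ : (MvPolynomial (Fin 3) k ⧸ surfIdeal k p) →ₐ[k] MvPolynomial (Fin 2) k)
    (hψ : ∀ F : MvPolynomial (Fin 3) k, ψ (Ideal.Quotient.mk (surfIdeal k p) F) = surfMap k p F) :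
    ((X 0 : MvPolynomial (Fin 3) k) ^ p - X 1 ^ p * X 2) ∈ RingHom.ker (surfMap k p) ∧
    Function.Injective ⇑ψ ∧
    RingHom.IsIntegral ψ.toRingHom ∧
    ∃ e : FractionRing (MvPolynomial (Fin 3) k ⧸ surfIdeal k p) ≃+*
        FractionRing (MvPolynomial (Fin 2) k),
      (∀ r : MvPolynomial (Fin 3) k ⧸ surfIdeal k p,
        e (algebraMap _ _ r) = algebraMap (MvPolynomial (Fin 2) k) _ (ψ r)) ∧
      e '' ((integralClosure (MvPolynomial (Fin 3) k ⧸ surfIdeal k p)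
          (FractionRing (MvPolynomial (Fin 3) k ⧸ surfIdeal k p)) :
            Subalgebra (MvPolynomial (Fin 3) k ⧸ surfIdeal k p)
              (FractionRing (MvPolynomial (Fin 3) k ⧸ surfIdeal k p))) :
            Set (FractionRing (MvPolynomial (Fin 3) k ⧸ surfIdeal k p))) =
        Set.range (algebraMap (MvPolynomial (Fin 2) k)
          (FractionRing (MvPolynomial (Fin 2) k))) := by
  have hinj : Function.Injective ψ := by
    refine Function.LeftInverse.injective (g := surfRetraction k p) fun r => ?_
    obtain ⟨F, rfl⟩ := Ideal.Quotient.mk_surjective r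
    rw [hψ, surfRetraction_surfMap k p hp]
  have hy : ψ (Ideal.Quotient.mk _ (X 1)) = X 1 := by simp [hψ, surfMap]
  have hx : ψ (Ideal.Quotient.mk _ (X 0)) = X 0 * X 1 := by simp [hψ, surfMap]
  have hz : ψ (Ideal.Quotient.mk _ (X 2)) = X 0 ^ p := by simp [hψ, surfMap]
  have hint : ψ.toRingHom.IsIntegral := by
    have hX (i : Fin 2) : ψ.toRingHom.IsIntegralElem (X i) := by
      fin_cases i
      · let := ψ.toRingHom.toAlgebra
        refine IsIntegral.of_pow (R := MvPolynomial (Fin 3) k ⧸ surfIdeal k p) hp ?_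
        change ψ.toRingHom.IsIntegralElem _
        simpa [hz] using ψ.toRingHom.isIntegralElem_map (x := Ideal.Quotient.mk _ (X 2))
      · simpa [hy] using ψ.toRingHom.isIntegralElem_map (x := Ideal.Quotient.mk _ (X 1))
    intro b
    induction b using MvPolynomial.induction_on with
    | C c =>
      have := ψ.toRingHom.isIntegralElem_map (x := algebraMap k _ c)
      rwa [show ψ.toRingHom (algebraMap k _ c) = C c from ψ.commutes c] at this
    | add f g hf hg => exact hf.add _ hg
    | mul_X f i hf => exact hf.mul _ (hX i)
  refine ⟨hker (Ideal.subset_span rfl), hinj, hint, ?_⟩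
  have : IsDomain (MvPolynomial (Fin 3) k ⧸ surfIdeal k p) := hinj.isDomain ψ.toRingHom
  refine exists_fractionRing_ringEquiv_image_integralClosure ψ.toRingHom hinj hint fun b => ?_
  change ∃ s, s ≠ 0 ∧ ∃ a, ψ s * b = ψ a
  have hX (i : Fin 2) : ∃ s, s ≠ 0 ∧ ∃ a, ψ s * X i = ψ a := by
    fin_cases i
    · refine ⟨Ideal.Quotient.mk _ (X 1), fun h => ?_, Ideal.Quotient.mk _ (X 0), ?_⟩
      · rw [h, map_zero] at hy
        exact X_ne_zero _ hy.symm
      · rw [hx, hy]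
        exact mul_comm _ _
    · exact ⟨1, one_ne_zero, Ideal.Quotient.mk _ (X 1), by simp [hy]⟩
  induction b using MvPolynomial.induction_on with
  | C c => exact ⟨1, one_ne_zero, algebraMap k _ c, by
      rw [map_one, one_mul, AlgHom.commutes, algebraMap_eq]⟩
  | add f g hf hg =>
    obtain ⟨s, hs, a, h⟩ := hf
    obtain ⟨t, ht, d, h'⟩ := hg
    refine ⟨s * t, mul_ne_zero hs ht, a * t + s * d, ?_⟩
    rw [map_add, map_mul, map_mul, map_mul, ← h, ← h']
    ring
  | mul_X f i hf =>
    obtain ⟨s, hs, a, h⟩ := hf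
    obtain ⟨t, ht, d, h'⟩ := hX i
    refine ⟨s * t, mul_ne_zero hs ht, a * d, ?_⟩
    rw [map_mul, map_mul, ← h, ← h']
    ring
end

section
/- Let k be a field, m ≥ 1, n ≥ 3, and let g₃,…,gₙ ∈ k[s,t] be homogeneous polynomials of degree m−1. Suppose that the k-linear map sending an (n−2)-tuple (l₃,…,lₙ) of homogeneous linear forms in k[s,t] to Σ_{i=3}^{n} lᵢ·gᵢ is surjective onto the space of homogeneous polynomials of degree m in k[s,t]. Then for every integer r ≥ 1, the k-linear map sending an (n−2)-tuple (B₃,…,Bₙ) of homogeneous polynomials of degree r in k[s,t] to Σ_{i=3}^{n} Bᵢ·gᵢ is surjective onto the space of homogeneous polynomials of degree m+r−1 in k[s,t]. -/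
open MvPolynomial

theorem MvPolynomial.homogeneousSubmodule_succ {σ R : Type*} [CommSemiring R] (d : ℕ) :
    homogeneousSubmodule σ R (d + 1) =
      homogeneousSubmodule σ R 1 * homogeneousSubmodule σ R d := by
  rw [← homogeneousSubmodule_one_pow, pow_succ', homogeneousSubmodule_one_pow]

/-- If every form of degree `d` is a combination of the `g i` with coefficients of degree `e`,
then every form of degree `d + 1` is one with coefficients of degree `e + 1`. -/
theorem MvPolynomial.exists_isHomogeneous_sum_mul_succ {σ R ι : Type*} [CommSemiring R]
    (s : Finset ι) (g : ι → MvPolynomial σ R) {d e : ℕ}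
    (h : ∀ p : MvPolynomial σ R, p.IsHomogeneous d →
      ∃ B : ι → MvPolynomial σ R, (∀ i, (B i).IsHomogeneous e) ∧ p = ∑ i ∈ s, B i * g i)
    {p : MvPolynomial σ R} (hp : p.IsHomogeneous (d + 1)) :
    ∃ B : ι → MvPolynomial σ R, (∀ i, (B i).IsHomogeneous (e + 1)) ∧
      p = ∑ i ∈ s, B i * g i := by
  rw [← mem_homogeneousSubmodule, homogeneousSubmodule_succ] at hp
  induction hp using Submodule.mul_induction_on' with
  | mem_mul_mem l hl q hq =>
    obtain ⟨B, hB, rfl⟩ := h q hq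
    refine ⟨fun i => l * B i, fun i => ?_, by simp only [Finset.mul_sum, mul_assoc]⟩
    rw [add_comm]
    exact IsHomogeneous.mul hl (hB i)
  | add x _ y _ hx hy =>
    obtain ⟨B, hB, rfl⟩ := hx
    obtain ⟨B', hB', rfl⟩ := hy
    exact ⟨fun i => B i + B' i, fun i => (hB i).add (hB' i),
      by simp only [add_mul, Finset.sum_add_distrib]⟩

/-- **Solvability of equation (*) for all `r ≥ 1`.**  Let `g₃,…,gₙ ∈ k[s,t]` be homogeneous
of degree `m-1`.  If every homogeneous polynomial of degree `m` is of the form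
`Σ lᵢ·gᵢ` with the `lᵢ` homogeneous linear forms, then for every `r ≥ 1` every homogeneous
polynomial of degree `m+r-1` is of the form `Σ Bᵢ·gᵢ` with the `Bᵢ` homogeneous of
degree `r`. -/
theorem star_solvable (k : Type) [Field k] (n m : ℕ) (hn : 3 ≤ n) (hm : 1 ≤ m)
    (g : Fin n → MvPolynomial (Fin 2) k)
    (hg : ∀ i, (g i).IsHomogeneous (m - 1))
    (hsurj : ∀ C : MvPolynomial (Fin 2) k, C.IsHomogeneous m →
      ∃ l : Fin n → MvPolynomial (Fin 2) k,
        (∀ i, (l i).IsHomogeneous 1) ∧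
        C = ∑ i ∈ Finset.univ.filter (fun i : Fin n => 2 ≤ (i : ℕ)), l i * g i) :
    ∀ r : ℕ, 1 ≤ r →
      ∀ C : MvPolynomial (Fin 2) k, C.IsHomogeneous (m + r - 1) →
        ∃ B : Fin n → MvPolynomial (Fin 2) k,
          (∀ i, (B i).IsHomogeneous r) ∧
          C = ∑ i ∈ Finset.univ.filter (fun i : Fin n => 2 ≤ (i : ℕ)), B i * g i := by
  intro r hr
  induction r, hr using Nat.le_induction with
  | base => simpa using hsurj
  | succ r hr ih =>
    intro C hC
    have hdeg : m + (r + 1) - 1 = m + r - 1 + 1 := by lia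
    rw [hdeg] at hC
    exact exists_isHomogeneous_sum_mul_succ _ g ih hC
end

section
/- Let e ≥ 2 be an integer and let σ ⊆ ℝ³ be the set of all nonnegative real linear combinations of e₁ = (1,0,0), e₂ = (0,1,0), e₃ = (1,1,e). Equip the lattice points of the topological interior σ° with the order v ≤ v′ iff v′ − v ∈ σ. Then the minimal elements of ℤ³ ∩ σ° with respect to this order are exactly the vectors (1,1,d) for 1 ≤ d ≤ e−1; in particular there are exactly e−1 of them. -/
/-- The cone generated by `(1,0,0)`, `(0,1,0)`, `(1,1,e)` in terms of its facet inequalities. -/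
lemma mem_cone_iff {e : ℝ} (he : 0 < e) (x : Fin 3 → ℝ) :
    (∃ a b c : ℝ, 0 ≤ a ∧ 0 ≤ b ∧ 0 ≤ c ∧
      x = a • ![(1 : ℝ), 0, 0] + b • ![(0 : ℝ), 1, 0] + c • ![(1 : ℝ), 1, e]) ↔
    0 ≤ x 2 ∧ x 2 ≤ e * x 0 ∧ x 2 ≤ e * x 1 := by
  constructor
  · rintro ⟨a, b, c, ha, hb, hc, rfl⟩
    have hae := mul_nonneg he.le ha
    have hbe := mul_nonneg he.le hb
    have hce := mul_nonneg he.le hc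
    simp
    refine ⟨?_, ?_, ?_⟩ <;> nlinarith
  · rintro ⟨h, h₀, h₁⟩
    refine ⟨x 0 - x 2 / e, x 1 - x 2 / e, x 2 / e, ?_, ?_, by positivity, ?_⟩
    · rw [sub_nonneg, div_le_iff₀ he]
      linarith
    · rw [sub_nonneg, div_le_iff₀ he]
      linarith
    · ext i
      fin_cases i <;> simp [he.ne']

/-- The interior of the cone is cut out by the strict facet inequalities. -/
lemma mem_interior_cone_iff {e : ℝ} (he : 1 < e) (x : Fin 3 → ℝ) :
    x ∈ interior {x : Fin 3 → ℝ | 0 ≤ x 2 ∧ x 2 ≤ e * x 0 ∧ x 2 ≤ e * x 1} ↔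
    0 < x 2 ∧ x 2 < e * x 0 ∧ x 2 < e * x 1 := by
  constructor
  · intro hx
    have hline : Continuous fun t : ℝ => fun i : Fin 3 => x i - t := by fun_prop
    have hnear := hline.continuousAt.preimage_mem_nhds (x := 0)
      (by simpa using mem_interior_iff_mem_nhds.mp hx)
    obtain ⟨t, ⟨h, h₀, h₁⟩, ht⟩ := Filter.nonempty_of_mem
      (Filter.inter_mem (mem_nhdsWithin_of_mem_nhds hnear) (self_mem_nhdsWithin (s := Set.Ioi 0)))
    have ht : 0 < t := ht
    have het := mul_pos (sub_pos.mpr he) ht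
    dsimp only at h h₀ h₁
    refine ⟨?_, ?_, ?_⟩ <;> nlinarith
  · intro hx
    have hopen : IsOpen {x : Fin 3 → ℝ | 0 < x 2 ∧ x 2 < e * x 0 ∧ x 2 < e * x 1} := by
      refine IsOpen.and ?_ (IsOpen.and ?_ ?_) <;> exact isOpen_lt (by fun_prop) (by fun_prop)
    refine interior_maximal ?_ hopen hx
    exact fun y hy => ⟨hy.1.le, hy.2.1.le, hy.2.2.le⟩

/-- The lattice points minimal in the interior of the cone, in terms of integer inequalities. -/
lemma minimal_lattice_point_iff {e : ℤ} (he : 2 ≤ e) (v : Fin 3 → ℤ) :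
    ((0 < v 2 ∧ v 2 < e * v 0 ∧ v 2 < e * v 1) ∧
      ∀ v' : Fin 3 → ℤ, (0 < v' 2 ∧ v' 2 < e * v' 0 ∧ v' 2 < e * v' 1) →
        (0 ≤ v 2 - v' 2 ∧ v 2 - v' 2 ≤ e * (v 0 - v' 0) ∧ v 2 - v' 2 ≤ e * (v 1 - v' 1)) →
        v' = v) ↔
    ∃ d : ℤ, (1 ≤ d ∧ d ≤ e - 1) ∧ ![1, 1, d] = v := by
  constructor
  · rintro ⟨⟨h, h₀, h₁⟩, hmin⟩
    have hx : 1 ≤ v 0 := by nlinarith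
    have hy : 1 ≤ v 1 := by nlinarith
    rcases lt_or_ge (v 2) e with hz | hz
    · refine ⟨v 2, ⟨h, by linarith⟩, hmin _ ?_ ?_⟩
      · simp [h, hz]
      · simp
        constructor <;> nlinarith
    · have hx : 2 ≤ v 0 := by nlinarith
      have hy : 2 ≤ v 1 := by nlinarith
      rcases hz.eq_or_lt with hz | hz
      · have hv := congrFun (hmin ![1, 1, 1] (by simp; omega)
          (by simp; refine ⟨?_, ?_, ?_⟩ <;> nlinarith)) 0
        simp at hv
        omega
      · have hv := congrFun (hmin ![v 0 - 1, v 1 - 1, v 2 - e]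
          (by simp; refine ⟨?_, ?_, ?_⟩ <;> nlinarith)
          (by simp; omega)) 0
        simp at hv
  · rintro ⟨d, ⟨hd, hde⟩, rfl⟩
    refine ⟨by simp; omega, fun v' ⟨h, h₀, h₁⟩ ⟨g, g₀, g₁⟩ => ?_⟩
    simp at g g₀ g₁
    have hx : v' 0 = 1 := le_antisymm (by nlinarith) (by nlinarith)
    have hy : v' 1 = 1 := le_antisymm (by nlinarith) (by nlinarith)
    have hz : v' 2 = d := by
      rw [hx] at g₀
      linarith
    ext i
    fin_cases i <;> simp [hx, hy, hz]


/-- **The example of Section 3.**  Let `σ ⊆ ℝ³` be the cone generated by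
`e₁ = (1,0,0)`, `e₂ = (0,1,0)`, `e₃ = (1,1,e)` with `e ≥ 2`.  With the order
`v ≤ v'` iff `v' − v ∈ σ` on the lattice points of the interior `σ°`, the minimal
elements of `ℤ³ ∩ σ°` are exactly `(1,1,d)` for `1 ≤ d ≤ e−1`; in particular
there are exactly `e − 1` of them. -/
theorem minimal_lattice_points_example (e : ℕ) (he : 2 ≤ e)
    (σ : Set (Fin 3 → ℝ))
    (hσ : σ = {x | ∃ a b c : ℝ, 0 ≤ a ∧ 0 ≤ b ∧ 0 ≤ c ∧
      x = a • ![(1 : ℝ), 0, 0] + b • ![(0 : ℝ), 1, 0] + c • ![(1 : ℝ), 1, (e : ℝ)]}) :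
    {v : Fin 3 → ℤ | (fun i => (v i : ℝ)) ∈ interior σ ∧
        ∀ v' : Fin 3 → ℤ, (fun i => (v' i : ℝ)) ∈ interior σ →
          (fun i => ((v i - v' i : ℤ) : ℝ)) ∈ σ → v' = v} =
      (fun d : ℤ => ![1, 1, d]) '' {d : ℤ | 1 ≤ d ∧ d ≤ (e : ℤ) - 1} ∧
    {v : Fin 3 → ℤ | (fun i => (v i : ℝ)) ∈ interior σ ∧
        ∀ v' : Fin 3 → ℤ, (fun i => (v' i : ℝ)) ∈ interior σ →
          (fun i => ((v i - v' i : ℤ) : ℝ)) ∈ σ → v' = v}.ncard = e - 1 := by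
  have he' : (1 : ℝ) < e := by exact_mod_cast he
  have hσ' : σ = {x | 0 ≤ x 2 ∧ x 2 ≤ (e : ℝ) * x 0 ∧ x 2 ≤ (e : ℝ) * x 1} := by
    rw [hσ]
    ext x
    exact mem_cone_iff (by linarith) x
  have hmin : {v : Fin 3 → ℤ | (fun i => (v i : ℝ)) ∈ interior σ ∧
        ∀ v' : Fin 3 → ℤ, (fun i => (v' i : ℝ)) ∈ interior σ →
          (fun i => ((v i - v' i : ℤ) : ℝ)) ∈ σ → v' = v} =
      (fun d : ℤ => ![1, 1, d]) '' {d : ℤ | 1 ≤ d ∧ d ≤ (e : ℤ) - 1} := by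
    ext v
    refine Iff.trans ?_ (minimal_lattice_point_iff (e := e) (by exact_mod_cast he) v)
    simp only [hσ', Set.mem_ofPred_eq, mem_interior_cone_iff he']
    norm_cast
  refine ⟨hmin, ?_⟩
  have hinj : Function.Injective fun d : ℤ => (![1, 1, d] : Fin 3 → ℤ) :=
    fun a b hab => by simpa using congrFun hab 2
  rw [hmin, Set.ncard_image_of_injective _ hinj]
  change (Set.Icc (1 : ℤ) (e - 1)).ncard = e - 1
  rw [← Finset.coe_Icc, Set.ncard_coe_finset, Int.card_Icc]
  omega
end

section
/- Let k ⊆ K be fields and let φ be a k-algebra homomorphism from the Laurent polynomial ring k[x₁^{±1},…,xₙ^{±1}] to the field K((t)) of formal Laurent series. Then there exists a unique vector v ∈ ℤⁿ such that for every u = (u₁,…,uₙ) ∈ ℤⁿ, the t-adic valuation of φ(x^u) equals ⟨v,u⟩ = Σ vᵢuᵢ (note φ(x^u) ≠ 0 since x^u is a unit). Moreover, if f₁,…,f_r ∈ ℤⁿ and τ ⊆ ℝⁿ is the set of nonnegative real linear combinations of f₁,…,f_r, then v ∈ τ if and only if φ(x^u) ∈ K⟦t⟧ for every u ∈ ℤⁿ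 with ⟨f_j,u⟩ ≥ 0 for all j = 1,…,r. -/
/-- **Farkas' lemma** for finitely many linear functionals on a vector space over a linearly
ordered field. -/
theorem exists_nonneg_sum_smul_of_forall_nonneg {F V : Type*} [Field F] [LinearOrder F]
    [IsStrictOrderedRing F] [AddCommGroup V] [Module F V] (r : ℕ) (a : Fin r → V →ₗ[F] F)
    (b : V →ₗ[F] F) (h : ∀ x, (∀ j, 0 ≤ a j x) → 0 ≤ b x) :
    ∃ c : Fin r → F, (∀ j, 0 ≤ c j) ∧ b = ∑ j, c j • a j := by
  induction r generalizing b with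
  | zero =>
    refine ⟨0, fun j => j.elim0, ?_⟩
    ext x
    have h₁ := h x fun j => j.elim0
    have h₂ := h (-x) fun j => j.elim0
    rw [map_neg] at h₂
    simpa using le_antisymm (by linarith) h₁
  | succ r ih =>
    by_cases hb : ∀ x, (∀ j : Fin r, 0 ≤ a j.succ x) → 0 ≤ b x
    · obtain ⟨c, hc, hbc⟩ := ih (fun j => a j.succ) b hb
      refine ⟨Fin.cons 0 c, Fin.cases le_rfl hc, ?_⟩
      simpa [Fin.sum_univ_succ] using hbc
    · push Not at hb
      obtain ⟨y, hy, hby⟩ := hb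
      have hay : a 0 y < 0 := by
        by_contra! hn
        exact hby.not_ge (h y (Fin.cases hn hy))
      obtain ⟨z, hz, hbz, haz⟩ : ∃ z, (∀ j : Fin r, 0 ≤ a j.succ z) ∧ b z < 0 ∧ a 0 z = -1 := by
        have hpos : 0 < (-a 0 y)⁻¹ := by simpa using hay
        refine ⟨(-a 0 y)⁻¹ • y, fun j => ?_, ?_, ?_⟩
        · rw [map_smul, smul_eq_mul]
          exact mul_nonneg hpos.le (hy j)
        · rw [map_smul, smul_eq_mul]
          exact mul_neg_of_pos_of_neg hpos hby
        · rw [map_smul, smul_eq_mul, inv_neg, neg_mul, inv_mul_cancel₀ hay.ne]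
      obtain ⟨c, hc, hbc⟩ := ih (fun j => a j.succ + a j.succ z • a 0) (b + b z • a 0)
        fun x hx => by
          have := h (x + a 0 x • z) <| Fin.cases (by simp [haz]) fun j => by
            simpa [mul_comm] using hx j
          simpa [mul_comm] using this
      refine ⟨Fin.cons (∑ j, c j * a j.succ z - b z) c, fun j => ?_, ?_⟩
      · have := Finset.sum_nonneg fun j (_ : j ∈ Finset.univ) => mul_nonneg (hc j) (hz j)
        refine j.cases ?_ hc
        rw [Fin.cons_zero]
        linarith
      · ext x
        have := LinearMap.congr_fun hbc x
        simp only [LinearMap.add_apply, LinearMap.smul_apply, LinearMap.sum_apply, smul_eq_mul,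
          mul_add, Finset.sum_add_distrib, ← mul_assoc, ← Finset.sum_mul] at this
        simp only [Fin.sum_univ_succ, Fin.cons_zero, Fin.cons_succ, LinearMap.add_apply,
          LinearMap.sum_apply, LinearMap.smul_apply, smul_eq_mul]
        linear_combination this

/-- A finite family of rational numbers has a common denominator. -/
theorem exists_pos_mul_eq_intCast {ι : Type*} [Fintype ι] (x : ι → ℚ) :
    ∃ N : ℚ, 0 < N ∧ ∃ u : ι → ℤ, ∀ i, (u i : ℚ) = N * x i := by
  refine ⟨((∏ i, (x i).den : ℕ) : ℚ), ?_, ?_⟩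
  · exact_mod_cast Finset.prod_pos fun i _ => (x i).den_pos
  · choose m hm using fun i => Finset.dvd_prod_of_mem (fun i => (x i).den) (Finset.mem_univ i)
    refine ⟨fun i => m i * (x i).num, fun i => ?_⟩
    rw [hm i]
    push_cast
    rw [mul_comm ((x i).den : ℚ), mul_assoc, Rat.den_mul_eq_num]

/-- **Farkas' lemma** for rational cones: an integer vector lies in the real cone spanned by
finitely many integer vectors if and only if it is nonnegative on the integer points of the dual cone. -/
theorem exists_nonneg_intCast_eq_sum_iff {n r : ℕ} (f : Fin r → Fin n → ℤ) (v : Fin n → ℤ) :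
    (∃ c : Fin r → ℝ, (∀ j, 0 ≤ c j) ∧
      (fun i => (v i : ℝ)) = ∑ j, c j • (fun i => (f j i : ℝ))) ↔
    ∀ u : Fin n → ℤ, (∀ j, 0 ≤ ∑ i, f j i * u i) → 0 ≤ ∑ i, v i * u i := by
  constructor
  · rintro ⟨c, hc, hv⟩ u hu
    have hvi (i : Fin n) : (v i : ℝ) = ∑ j, c j * f j i := by
      simpa using congrFun hv i
    have key : ((∑ i, v i * u i : ℤ) : ℝ) = ∑ j, c j * ((∑ i, f j i * u i : ℤ) : ℝ) := by
      push_cast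
      simp only [hvi, Finset.sum_mul, Finset.mul_sum, mul_assoc]
      exact Finset.sum_comm
    have : (0 : ℝ) ≤ ((∑ i, v i * u i : ℤ) : ℝ) := by
      rw [key]
      exact Finset.sum_nonneg fun j _ => mul_nonneg (hc j) (by exact_mod_cast hu j)
    exact_mod_cast this
  · intro h
    let L (w : Fin n → ℤ) : (Fin n → ℚ) →ₗ[ℚ] ℚ := ∑ i, (w i : ℚ) • LinearMap.proj i
    have hL (w : Fin n → ℤ) (x : Fin n → ℚ) : L w x = ∑ i, w i * x i := by simp [L]
    have hscale {N : ℚ} {x : Fin n → ℚ} {u : Fin n → ℤ} (hu : ∀ i, (u i : ℚ) = N * x i)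
        (w : Fin n → ℤ) : ((∑ i, w i * u i : ℤ) : ℚ) = N * L w x := by
      push_cast
      simp only [hL, hu, Finset.mul_sum, mul_left_comm]
    obtain ⟨c, hc, hv⟩ := exists_nonneg_sum_smul_of_forall_nonneg r (fun j => L (f j)) (L v)
      fun x hx => by
        obtain ⟨N, hN, u, hu⟩ := exists_pos_mul_eq_intCast x
        refine nonneg_of_mul_nonneg_right ?_ hN
        rw [← hscale hu]
        refine Int.cast_nonneg (h u fun j => ?_)
        have := mul_nonneg hN.le (hx j)
        rw [← hscale hu] at this
        exact_mod_cast this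
    refine ⟨fun j => c j, fun j => Rat.cast_nonneg.mpr (hc j), ?_⟩
    ext i
    have hi : (v i : ℚ) = ∑ j, c j * f j i := by
      simpa [hL, Pi.single_apply] using LinearMap.congr_fun hv (Pi.single i 1)
    have : ((v i : ℚ) : ℝ) = ((∑ j, c j * f j i : ℚ) : ℝ) := by rw [hi]
    simpa using this

/-- A Laurent series is a power series if and only if its order is nonnegative. -/
theorem LaurentSeries.mem_range_ofPowerSeries_iff {R : Type*} [CommRing R] (g : LaurentSeries R) :
    g ∈ Set.range (HahnSeries.ofPowerSeries ℤ R) ↔ 0 ≤ g.order := by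
  constructor
  · rintro ⟨p, rfl⟩
    by_contra! hneg
    have hne : HahnSeries.ofPowerSeries ℤ R p ≠ 0 := by
      intro h0
      simp [h0] at hneg
    apply HahnSeries.coeff_order_eq_zero.not.mpr hne
    rw [PowerSeries.coeff_coe, if_pos hneg]
  · intro h
    exact ⟨_, X_order_mul_powerSeriesPart (n := g.order.toNat) (by simp [h])⟩

/-- The order of the image of a monomial, as an additive map of its exponent. -/
noncomputable def monomialOrderHom {k K G : Type*} [Field k] [Field K] [Algebra k K]
    [AddCommGroup G] (φ : AddMonoidAlgebra k G →ₐ[k] LaurentSeries K) : G →+ ℤ where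
  toFun u := (φ (AddMonoidAlgebra.single u 1)).order
  map_zero' := by
    rw [← AddMonoidAlgebra.one_def, map_one, HahnSeries.order_one]
  map_add' u w := by
    have hne (u : G) : φ (AddMonoidAlgebra.single u 1) ≠ 0 := by
      refine left_ne_zero_of_mul_eq_one (b := φ (AddMonoidAlgebra.single (-u) 1)) ?_
      rw [← map_mul, AddMonoidAlgebra.single_mul_single, add_neg_cancel, mul_one,
        ← AddMonoidAlgebra.one_def, map_one]
    rw [← HahnSeries.order_mul (hne u) (hne w), ← map_mul, AddMonoidAlgebra.single_mul_single,
      mul_one]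

/-- **The valuation vector of an arc on a torus (Proposition 3.10(i)).**
Let `k ⊆ K` be fields and `φ : k[x₁^{±1},…,xₙ^{±1}] → K((t))` a `k`-algebra
homomorphism from the Laurent polynomial ring (the group algebra of `ℤⁿ`).  There
is a unique `v ∈ ℤⁿ` with `ord(φ(x^u)) = ⟨v,u⟩` for all `u ∈ ℤⁿ`.  Moreover, for a
cone `τ` generated by integer vectors `f₁,…,f_r`, one has `v ∈ τ` iff `φ(x^u) ∈ K⟦t⟧`
for every `u ∈ ℤⁿ` with `⟨f_j,u⟩ ≥ 0` for all `j`. -/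
theorem arc_valuation_vector (k K : Type) [Field k] [Field K] [Algebra k K] (n r : ℕ)
    (φ : AddMonoidAlgebra k (Fin n → ℤ) →ₐ[k] LaurentSeries K)
    (f : Fin r → (Fin n → ℤ)) (τ : Set (Fin n → ℝ))
    (hτ : τ = {x | ∃ c : Fin r → ℝ, (∀ j, 0 ≤ c j) ∧
      x = ∑ j, c j • (fun i => (f j i : ℝ))}) :
    (∃! v : Fin n → ℤ, ∀ u : Fin n → ℤ,
      (φ (AddMonoidAlgebra.single u (1 : k))).order = ∑ i, v i * u i) ∧
    (∀ v : Fin n → ℤ,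
      (∀ u : Fin n → ℤ, (φ (AddMonoidAlgebra.single u (1 : k))).order = ∑ i, v i * u i) →
      ((fun i => (v i : ℝ)) ∈ τ ↔
        ∀ u : Fin n → ℤ, (∀ j, 0 ≤ ∑ i, f j i * u i) →
          φ (AddMonoidAlgebra.single u (1 : k)) ∈
            Set.range (HahnSeries.ofPowerSeries ℤ K))) := by
  subst hτ
  refine ⟨⟨fun i => monomialOrderHom φ (Pi.single i 1), fun u => ?_, fun w hw => ?_⟩,
    fun v hv => ?_⟩
  · have := LinearMap.pi_apply_eq_sum_univ (monomialOrderHom φ).toIntLinearMap u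
    simp only [AddMonoidHom.coe_toIntLinearMap, smul_eq_mul] at this
    refine this.trans (Finset.sum_congr rfl fun i _ => ?_)
    rw [mul_comm]
    congr 2
    ext j
    simp [Pi.single_apply, eq_comm]
  · ext i
    simpa [Pi.single_apply, monomialOrderHom] using (hw (Pi.single i 1)).symm
  · simp only [LaurentSeries.mem_range_ofPowerSeries_iff, hv]
    exact exists_nonneg_intCast_eq_sum_iff f v
end
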